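/- A continuous positive semi-definite function C : ℝ → ℂ can be written as C(t) = ∫ exp(2πi t ν) dS(ν) for a finite positive Borel measure S on ℝ, with total mass S(ℝ) = C(0). -/

import Mathlib

open MeasureTheory ComplexConjugate Real
open scoped ComplexOrder
open ProbabilityTheory Filter
open scoped Topology FourierTransform NNReal RealInnerProductSpace

/-- A function `C : ℝ → ℂ` is positive semi-definite if all the matrices `C (t k - t j)` are. -/
def IsPosSemidefFun (C : ℝ → ℂ) : Prop :=
  ∀ (n : ℕ) (t : Fin n → ℝ) (z : Fin n → ℂ), 0 ≤ ∑ j, ∑ k, conj (z j) * C (t k - t j) * z k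

namespace IsPosSemidefFun

variable {C : ℝ → ℂ}

lemma apply_zero_nonneg (hC : IsPosSemidefFun C) : 0 ≤ C 0 := by
  simpa using hC 1 0 1

lemma add_nonneg (hC : IsPosSemidefFun C) (t : ℝ) (z : ℂ) :
    0 ≤ C 0 + C t * z + conj z * C (-t) + conj z * C 0 * z := by
  have := hC 2 ![0, t] ![1, z]
  simpa [Fin.sum_univ_two, add_assoc] using this

lemma apply_neg (hC : IsPosSemidefFun C) (t : ℝ) : C (-t) = conj (C t) := by
  have h0 := (Complex.nonneg_iff.1 hC.apply_zero_nonneg).2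
  have h1 := (Complex.nonneg_iff.1 (hC.add_nonneg t 1)).2
  have h2 := (Complex.nonneg_iff.1 (hC.add_nonneg t Complex.I)).2
  simp at h0 h1 h2
  apply Complex.ext <;> simp <;> linarith

lemma norm_apply_le (hC : IsPosSemidefFun C) (t : ℝ) : ‖C t‖ ≤ (C 0).re := by
  by_cases h : C t = 0
  · simpa [h] using (Complex.nonneg_iff.1 hC.apply_zero_nonneg).1
  have hn : (‖C t‖ : ℂ) ≠ 0 := by simpa using h
  have h1 := hC.add_nonneg t (-(conj (C t) / ‖C t‖))
  have h2 : C t * conj (C t) = (‖C t‖ : ℂ) ^ 2 := Complex.mul_conj' _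
  have h3 : C 0 + C t * (-(conj (C t) / ‖C t‖)) + conj (-(conj (C t) / ‖C t‖)) * C (-t)
      + conj (-(conj (C t) / ‖C t‖)) * C 0 * (-(conj (C t) / ‖C t‖))
      = 2 * (C 0 - ‖C t‖) := by
    rw [hC.apply_neg]
    simp only [map_neg, map_div₀, Complex.conj_conj, Complex.conj_ofReal]
    field_simp
    linear_combination (C 0 - 2 * ‖C t‖) * h2
  rw [h3] at h1
  have := (Complex.nonneg_iff.1 h1).1
  simp at this
  linarith

/-- Multiplying by a nonnegative scalar preserves positive semi-definiteness. -/
lemma const_mul (hC : IsPosSemidefFun C) {r : ℂ} (hr : 0 ≤ r) :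
    IsPosSemidefFun (fun t ↦ r * C t) := by
  intro n t z
  convert mul_nonneg hr (hC n t z) using 1
  simp only [Finset.mul_sum]
  exact Finset.sum_congr rfl fun j _ ↦ Finset.sum_congr rfl fun k _ ↦ by ring

end IsPosSemidefFun

/-- If all the double sums of a bounded kernel over finite samples are nonnegative, then so is its
integral with respect to the square of a probability measure. -/
lemma integral_prod_self_nonneg_of_sum_nonneg {Ω : Type*} [MeasurableSpace Ω]
    (γ : Measure Ω) [IsProbabilityMeasure γ] {K : Ω × Ω → ℂ} (hK : Measurable K) {M : ℝ}
    (hM : ∀ p, ‖K p‖ ≤ M) (hpos : ∀ (n : ℕ) (x : Fin n → Ω), 0 ≤ ∑ j, ∑ k, K (x j, x k)) :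
    0 ≤ ∫ p, K p ∂γ.prod γ := by
  set A : ℂ := ∫ x, K (x, x) ∂γ with hA
  set B : ℂ := ∫ p, K p ∂γ.prod γ with hB
  have hsum (n : ℕ) : 0 ≤ n * A + (n * n - n) * B := by
    let P : Measure (Fin n → Ω) := Measure.pi fun _ ↦ γ
    have hterm (j k : Fin n) : ∫ x, K (x j, x k) ∂P = B + if j = k then A - B else 0 := by
      split_ifs with hjk
      · subst hjk
        rw [add_sub_cancel, hA, ← (measurePreserving_eval (fun _ : Fin n ↦ γ) j).map_eq,
          integral_map (measurable_pi_apply j).aemeasurable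
            (Measurable.aestronglyMeasurable (by fun_prop))]
      · have hind : IndepFun (fun x : Fin n → Ω ↦ x j) (fun x ↦ x k) P :=
          (iIndepFun_pi (μ := fun _ : Fin n ↦ γ) (X := fun _ ↦ id)
            fun _ ↦ aemeasurable_id).indepFun hjk
        have hmap := (indepFun_iff_map_prod_eq_prod_map_map (measurable_pi_apply j).aemeasurable
          (measurable_pi_apply k).aemeasurable).1 hind
        have hm (i : Fin n) : P.map (fun x ↦ x i) = γ :=
          (measurePreserving_eval (fun _ : Fin n ↦ γ) i).map_eq
        rw [hm, hm] at hmap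
        rw [add_zero, hB, ← hmap, integral_map (Measurable.aemeasurable (by fun_prop))
          hK.aestronglyMeasurable]
    have hint (j k : Fin n) : Integrable (fun x ↦ K (x j, x k)) P :=
      .of_bound (Measurable.aestronglyMeasurable (by fun_prop)) M (ae_of_all _ fun _ ↦ hM _)
    have h := integral_nonneg (μ := P) (f := fun x ↦ ∑ j, ∑ k, K (x j, x k)) fun x ↦ hpos n x
    rw [integral_finsetSum _ fun j _ ↦ integrable_finsetSum _ fun k _ ↦ hint j k] at h
    simp_rw [integral_finsetSum _ fun k _ ↦ hint _ k, hterm] at h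
    simp [Finset.sum_add_distrib] at h
    convert h using 1
    ring
  have hlim : Tendsto (fun n : ℕ ↦ (n : ℂ)⁻¹ * A + (1 - (n : ℂ)⁻¹) * B) atTop (𝓝 B) := by
    have h0 : Tendsto (fun n : ℕ ↦ (n : ℂ)⁻¹) atTop (𝓝 0) := tendsto_inv_atTop_nhds_zero_nat
    simpa using (h0.mul_const A).add ((h0.const_sub 1).mul_const B)
  refine ge_of_tendsto hlim (eventually_ne_atTop 0 |>.mono fun n hn ↦ ?_)
  have hn' : (n : ℂ) ≠ 0 := by exact_mod_cast hn
  have hnn : 0 ≤ (((n : ℝ)⁻¹ ^ 2 : ℝ) : ℂ) := Complex.zero_le_real.2 (sq_nonneg _)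
  convert mul_nonneg hnn (hsum n) using 1
  push_cast
  field_simp

lemma map_sub_gaussianReal_prod (v : ℝ≥0) :
    ((gaussianReal 0 v).prod (gaussianReal 0 v)).map (fun p ↦ p.2 - p.1)
      = gaussianReal 0 (v + v) := by
  have hind : IndepFun (fun p : ℝ × ℝ ↦ -p.1) (fun p ↦ p.2)
      ((gaussianReal 0 v).prod (gaussianReal 0 v)) :=
    indepFun_prod (X := fun x : ℝ ↦ -x) (Y := id) (by fun_prop) (by fun_prop)
  have h := gaussianReal_add_gaussianReal_of_indepFun (m₁ := 0) (v₁ := v) (m₂ := 0) (v₂ := v) hind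
    (by
      rw [show (fun p : ℝ × ℝ ↦ -p.1) = (fun x ↦ -x) ∘ Prod.fst from rfl,
        ← Measure.map_map (by fun_prop) (by fun_prop), Measure.map_fst_prod]
      simp [gaussianReal_map_neg])
    (by simp)
  rw [add_zero] at h
  rw [← h]
  congr 1
  ext p
  simp [sub_eq_neg_add]

namespace IsPosSemidefFun

variable {C : ℝ → ℂ}

lemma integral_gaussianReal_nonneg (hC : IsPosSemidefFun C) (hcont : Continuous C) (v : ℝ≥0)
    (ν : ℝ) : 0 ≤ ∫ x, Complex.exp (-2 * π * Complex.I * x * ν) * C x ∂gaussianReal 0 (v + v) := by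
  rw [← map_sub_gaussianReal_prod,
    integral_map (by fun_prop) (Continuous.aestronglyMeasurable (by fun_prop))]
  refine integral_prod_self_nonneg_of_sum_nonneg _ (Continuous.measurable (by fun_prop))
    (M := (C 0).re) (fun p ↦ ?_) fun n x ↦ ?_
  · rw [norm_mul, show -2 * π * Complex.I * ((p.2 - p.1 : ℝ) : ℂ) * ν
      = ((-2 * π * (p.2 - p.1) * ν : ℝ) : ℂ) * Complex.I by push_cast; ring,
      Complex.norm_exp_ofReal_mul_I, one_mul]
    exact hC.norm_apply_le _
  · convert hC n x fun j ↦ Complex.exp (-2 * π * Complex.I * x j * ν) using 3 with j _ k _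
    rw [← Complex.exp_conj, mul_right_comm (Complex.exp _) (C _), ← Complex.exp_add]
    congr 2
    simp only [map_mul, map_neg, Complex.conj_I, Complex.conj_ofReal, Complex.conj_ofNat]
    push_cast
    ring

lemma fourier_gaussian_mul_nonneg (hC : IsPosSemidefFun C) (hcont : Continuous C) {b : ℝ}
    (hb : 0 < b) (ν : ℝ) : 0 ≤ 𝓕 (fun x : ℝ ↦ (rexp (-b * x ^ 2) : ℂ) * C x) ν := by
  let v : ℝ≥0 := ⟨(4 * b)⁻¹, by positivity⟩
  have hv : (v : ℝ) = (4 * b)⁻¹ := rfl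
  have hv0 : v + v ≠ 0 := by
    rw [← NNReal.coe_ne_zero]; push_cast; rw [hv]; positivity
  have h := hC.integral_gaussianReal_nonneg hcont v ν
  rw [integral_gaussianReal_eq_integral_smul hv0] at h
  have hs : 0 ≤ (√(2 * π * ↑(v + v)) : ℂ) := by exact_mod_cast Real.sqrt_nonneg _
  have hs0 : (√(2 * π * ↑(v + v)) : ℂ) ≠ 0 := by
    have : 0 < ((v + v : ℝ≥0) : ℝ) := by exact_mod_cast pos_iff_ne_zero.2 hv0
    exact_mod_cast (by positivity : √(2 * π * ↑(v + v)) ≠ 0)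
  convert mul_nonneg hs h using 1
  rw [← integral_const_mul, Real.fourier_eq']
  congr 1 with x
  have hexp : -(x - 0) ^ 2 / (2 * ((v + v : ℝ≥0) : ℝ)) = -b * x ^ 2 := by
    push_cast; rw [hv]; field_simp; ring
  rw [gaussianPDFReal, hexp, Complex.real_smul]
  rw [Complex.ofReal_mul (_⁻¹), Complex.ofReal_inv, mul_assoc (_⁻¹), mul_inv_cancel_left₀ hs0,
    smul_eq_mul, mul_left_comm]
  simp only [RCLike.inner_apply, conj_trivial]
  push_cast
  ring_nf

end IsPosSemidefFun

section
variable {V : Type*} [NormedAddCommGroup V] [InnerProductSpace ℝ V] [MeasurableSpace V]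
  [BorelSpace V] [FiniteDimensional ℝ V]

lemma tendsto_integral_gaussian_mul_fourier {f : V → ℂ} (hf : Integrable f)
    (h0 : ContinuousAt f 0) :
    Tendsto (fun c : ℝ ↦ ∫ w : V, Complex.exp (-(c : ℂ)⁻¹ * ‖w‖ ^ 2) * 𝓕 f w) atTop
      (𝓝 (f 0)) := by
  refine (Real.tendsto_integral_gaussian_smul' hf h0).congr' ?_
  filter_upwards [eventually_gt_atTop 0] with c hc
  have hc' : 0 < ((c : ℂ)⁻¹).re := by rw [← Complex.ofReal_inv]; simpa
  have hint : Integrable fun w : V ↦ Complex.exp (-(c : ℂ)⁻¹ * ‖w‖ ^ 2) := by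
    simpa using GaussianFourier.integrable_cexp_neg_mul_sq_norm_add hc' 0 (0 : V)
  have h := VectorFourier.integral_fourierIntegral_smul_eq_flip (L := innerₗ V)
    Real.continuous_fourierChar continuous_inner hint hf
  rw [flip_innerₗ] at h
  refine Eq.trans ?_ h
  congr 1 with w
  change _ = 𝓕 (fun w : V ↦ Complex.exp (-(c : ℂ)⁻¹ * ‖w‖ ^ 2)) w • f w
  rw [fourier_gaussian_innerProductSpace hc']
  simp only [zero_sub, norm_neg, div_inv_eq_mul]
  ring_nf

/-- An integrable function which is continuous at `0` and has nonnegative Fourier transform has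
integrable Fourier transform. -/
lemma integrable_fourier_of_nonneg {f : V → ℂ} (hf : Integrable f) (h0 : ContinuousAt f 0)
    (hpos : ∀ w, 0 ≤ 𝓕 f w) : Integrable (𝓕 f) := by
  have hFc : Continuous (𝓕 f) :=
    VectorFourier.fourierIntegral_continuous Real.continuous_fourierChar
      (L := innerₗ V) continuous_inner hf
  set g : ℝ → V → ℂ := fun c w ↦ Complex.exp (-(c : ℂ)⁻¹ * ‖w‖ ^ 2) * 𝓕 f w with hg
  have hgc (c : ℝ) : Continuous (g c) := by fun_prop
  have hgint {c : ℝ} (hc : 0 < c) : Integrable (g c) := by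
    have hc' : 0 < ((c : ℂ)⁻¹).re := by rw [← Complex.ofReal_inv]; simpa
    have hint : Integrable fun w : V ↦ Complex.exp (-(c : ℂ)⁻¹ * ‖w‖ ^ 2) := by
      simpa using GaussianFourier.integrable_cexp_neg_mul_sq_norm_add hc' 0 (0 : V)
    exact hint.mul_bdd (c := ∫ v, ‖f v‖) hFc.aestronglyMeasurable
      (ae_of_all _ fun w ↦ VectorFourier.norm_fourierIntegral_le_integral_norm _ _ _ _ _)
  have hgnorm (c : ℝ) (w : V) : (‖g c w‖ : ℂ) = g c w := by
    have hexp : Complex.exp (-(c : ℂ)⁻¹ * ‖w‖ ^ 2) = (rexp (-c⁻¹ * ‖w‖ ^ 2) : ℂ) := by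
      push_cast; rfl
    have : 0 ≤ g c w := by
      simp only [hg, hexp]
      exact mul_nonneg (Complex.zero_le_real.2 (Real.exp_nonneg _)) (hpos w)
    exact (Complex.eq_coe_norm_of_nonneg this).symm
  have hT : Tendsto (fun c ↦ ∫ w, ‖g c w‖) atTop (𝓝 (f 0).re) := by
    refine ((Complex.continuous_re.tendsto _).comp
      (tendsto_integral_gaussian_mul_fourier hf h0)).congr fun c ↦ ?_
    change (∫ w, g c w).re = _
    rw [← integral_congr_ae (ae_of_all _ (hgnorm c)), integral_complex_ofReal, Complex.ofReal_re]
  have hT' : Tendsto (fun c ↦ ∫⁻ w, ‖g c w‖ₑ) atTop (𝓝 (ENNReal.ofReal (f 0).re)) := by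
    refine (ENNReal.tendsto_ofReal hT).congr' ?_
    filter_upwards [eventually_gt_atTop 0] with c hc
    exact ofReal_integral_norm_eq_lintegral_enorm (hgint hc)
  have hlim (w : V) : Tendsto (fun c ↦ g c w) atTop (𝓝 (𝓕 f w)) := by
    have : Tendsto (fun c : ℝ ↦ Complex.exp (-((c⁻¹ : ℝ) : ℂ) * ‖w‖ ^ 2) * 𝓕 f w) atTop
        (𝓝 (Complex.exp (-((0 : ℝ) : ℂ) * ‖w‖ ^ 2) * 𝓕 f w)) :=
      (tendsto_inv_atTop_zero.ofReal.neg.mul_const _).cexp.mul_const _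
    simpa [hg] using this
  refine ⟨hFc.aestronglyMeasurable, ?_⟩
  calc ∫⁻ w, ‖𝓕 f w‖ₑ
    _ = ∫⁻ w, liminf (fun c ↦ ‖g c w‖ₑ) atTop :=
      lintegral_congr fun w ↦ (hlim w).enorm.liminf_eq.symm
    _ ≤ liminf (fun c ↦ ∫⁻ w, ‖g c w‖ₑ) atTop :=
      lintegral_liminf_le fun c ↦ (hgc c).enorm.measurable
    _ < ⊤ := hT'.liminf_eq ▸ ENNReal.ofReal_lt_top

end

/-- A continuous integrable function on `ℝ` with nonnegative Fourier transform, normalized at `0`,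
is the characteristic function of a probability measure, up to scaling. -/
lemma exists_probabilityMeasure_charFun_eq_of_fourier_nonneg {f : ℝ → ℂ} (hf : Integrable f)
    (hcont : Continuous f) (hpos : ∀ w, 0 ≤ 𝓕 f w) (h0 : f 0 = 1) :
    ∃ μ : ProbabilityMeasure ℝ, ∀ t, charFun (μ : Measure ℝ) (2 * π * t) = f t := by
  have hint := integrable_fourier_of_nonneg hf hcont.continuousAt hpos
  have hre (w : ℝ) : ((𝓕 f w).re : ℂ) = 𝓕 f w :=
    Complex.ext rfl (by simpa using (Complex.nonneg_iff.1 (hpos w)).2)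
  have hre0 (w : ℝ) : 0 ≤ (𝓕 f w).re := (Complex.nonneg_iff.1 (hpos w)).1
  have hFc : Continuous (𝓕 f) :=
    VectorFourier.fourierIntegral_continuous Real.continuous_fourierChar
      (L := innerₗ ℝ) continuous_inner hf
  have hinv (t : ℝ) : ∫ w : ℝ, Complex.exp (2 * π * w * t * Complex.I) * 𝓕 f w = f t := by
    rw [← congr_fun (hcont.fourierInv_fourier_eq hf hint) t, Real.fourierInv_eq']
    congr 1 with w
    simp only [RCLike.inner_apply, conj_trivial, smul_eq_mul]
    push_cast
    ring_nf
  have hmass : ∫ w, (𝓕 f w).re = 1 := by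
    have h := hinv 0
    simp only [Complex.ofReal_zero, mul_zero, zero_mul, Complex.exp_zero, one_mul, h0] at h
    rw [← integral_congr_ae (ae_of_all _ hre), integral_complex_ofReal] at h
    exact_mod_cast h
  let μ : Measure ℝ := volume.withDensity fun w ↦ ENNReal.ofReal (𝓕 f w).re
  have hμ : IsProbabilityMeasure μ := ⟨by
    have h := ofReal_integral_eq_lintegral_ofReal hint.re (ae_of_all _ hre0)
    rw [withDensity_apply _ .univ, setLIntegral_univ]
    exact h.symm.trans (ENNReal.ofReal_eq_one.2 hmass)⟩
  refine ⟨⟨μ, hμ⟩, fun t ↦ ?_⟩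
  rw [charFun_apply_real, ← hinv t]
  refine (integral_withDensity_eq_integral_toReal_smul (Measurable.ennreal_ofReal
    (Complex.measurable_re.comp hFc.measurable))
    (ae_of_all _ fun _ ↦ ENNReal.ofReal_lt_top) _).trans ?_
  congr 1 with w
  simp only [Function.comp_apply]
  rw [ENNReal.toReal_ofReal (hre0 w), Complex.real_smul, hre, mul_comm]
  push_cast
  ring_nf

/-- A pointwise limit of characteristic functions which is continuous at `0` is a characteristic
function. -/
lemma exists_charFun_eq_of_tendsto {E : Type*} [NormedAddCommGroup E] [InnerProductSpace ℝ E]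
    [FiniteDimensional ℝ E] [MeasurableSpace E] [BorelSpace E] {μ : ℕ → ProbabilityMeasure E}
    {f : E → ℂ} (hf : ContinuousAt f 0)
    (h : ∀ t, Tendsto (fun n ↦ charFun (μ n : Measure E) t) atTop (𝓝 (f t))) :
    ∃ μ₀ : ProbabilityMeasure E, ∀ t, charFun (μ₀ : Measure E) t = f t := by
  have htight := isTightMeasureSet_of_tendsto_charFun hf h
  have hcomp : IsCompact (closure (Set.range μ)) :=
    isCompact_closure_of_isTightMeasureSet (by simpa [Set.range] using htight)
  obtain ⟨μ₀, -, hμ₀⟩ := hcomp.ultrafilter_le_nhds ((Ultrafilter.of atTop).map μ)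
    (.trans (by simp) (monotone_principal subset_closure))
  refine ⟨μ₀, fun t ↦ tendsto_nhds_unique ?_ ((h t).mono_left (Ultrafilter.of_le atTop))⟩
  have hlim : Tendsto μ ↑(Ultrafilter.of (atTop : Filter ℕ)) (𝓝 μ₀) := hμ₀
  rw [ProbabilityMeasure.tendsto_iff_forall_integral_rclike_tendsto ℂ] at hlim
  simp_rw [charFun_eq_integral_innerProbChar]
  exact hlim _

namespace IsPosSemidefFun

variable {C : ℝ → ℂ}

/-- **Bochner's theorem**, in terms of characteristic functions of probability measures. -/
theorem exists_probabilityMeasure_charFun_eq (hC : IsPosSemidefFun C) (hcont : Continuous C)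
    (h0 : C 0 = 1) :
    ∃ μ : ProbabilityMeasure ℝ, ∀ t, charFun (μ : Measure ℝ) (2 * π * t) = C t := by
  have hgauss {b : ℝ} (hb : 0 < b) : Integrable fun x : ℝ ↦ (rexp (-b * x ^ 2) : ℂ) * C x :=
    (integrable_exp_neg_mul_sq hb).ofReal.mul_bdd hcont.aestronglyMeasurable
      (ae_of_all _ hC.norm_apply_le)
  have happrox (n : ℕ) : ∃ μ : ProbabilityMeasure ℝ, ∀ t : ℝ,
      charFun (μ : Measure ℝ) (2 * π * t) = (rexp (-(1 / ((n : ℝ) + 1)) * t ^ 2) : ℂ) * C t :=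
    exists_probabilityMeasure_charFun_eq_of_fourier_nonneg (hgauss Nat.one_div_pos_of_nat)
      (by fun_prop) (hC.fourier_gaussian_mul_nonneg hcont Nat.one_div_pos_of_nat) (by simp [h0])
  choose μ hμ using happrox
  have hscale (t : ℝ) : 2 * π * ((2 * π)⁻¹ * t) = t := mul_inv_cancel_left₀ (by positivity) t
  have hlim (s : ℝ) : Tendsto (fun n : ℕ ↦ (rexp (-(1 / ((n : ℝ) + 1)) * s ^ 2) : ℂ) * C s)
      atTop (𝓝 ((rexp (-0 * s ^ 2) : ℂ) * C s)) :=
    ((Real.continuous_exp.tendsto _).comp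
      (tendsto_one_div_add_atTop_nhds_zero_nat.neg.mul_const _)).ofReal.mul_const _
  obtain ⟨μ₀, hμ₀⟩ := exists_charFun_eq_of_tendsto (μ := μ) (f := fun t ↦ C ((2 * π)⁻¹ * t))
    (by fun_prop) fun t ↦ by
      have h := hlim ((2 * π)⁻¹ * t)
      simp_rw [← hμ, hscale] at h
      simpa using h
  exact ⟨μ₀, fun t ↦ by rw [hμ₀, inv_mul_cancel_left₀ (by positivity)]⟩

end IsPosSemidefFun

/-- Bochner's theorem: a continuous positive semi-definite function
`C : ℝ → ℂ` is the Fourier–Stieltjes transform of a finite positive Borel measure `S`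
on the frequency line, with total mass `S(ℝ) = C 0`. -/
theorem bochner (C : ℝ → ℂ) (hcont : Continuous C)
    (hpos : ∀ (n : ℕ) (t : Fin n → ℝ) (z : Fin n → ℂ),
      0 ≤ ∑ j, ∑ k, conj (z j) * C (t k - t j) * z k) :
    ∃ S : Measure ℝ, IsFiniteMeasure S ∧
      (∀ t : ℝ, C t = ∫ ν, Complex.exp (2 * π * Complex.I * t * ν) ∂S) ∧
      S Set.univ = ENNReal.ofReal (C 0).re := by
  have hC : IsPosSemidefFun C := hpos
  have hre : ((C 0).re : ℂ) = C 0 :=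
    Complex.ext rfl (by simpa using (Complex.nonneg_iff.1 hC.apply_zero_nonneg).2)
  rcases (Complex.nonneg_iff.1 hC.apply_zero_nonneg).1.eq_or_lt with h0 | h0
  · refine ⟨0, inferInstance, fun t ↦ ?_, by simp [← h0]⟩
    simpa using (hC.norm_apply_le t).trans h0.ge
  have hne : C 0 ≠ 0 := by rw [← hre]; exact_mod_cast h0.ne'
  have hinv : 0 ≤ (C 0)⁻¹ := by
    rw [← hre, ← Complex.ofReal_inv]
    exact Complex.zero_le_real.2 (inv_nonneg.2 h0.le)
  obtain ⟨μ, hμ⟩ :=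
    (hC.const_mul hinv).exists_probabilityMeasure_charFun_eq (by fun_prop) (inv_mul_cancel₀ hne)
  refine ⟨ENNReal.ofReal (C 0).re • (μ : Measure ℝ),
    Measure.smul_finite _ ENNReal.ofReal_ne_top, fun t ↦ ?_, by simp⟩
  have h := hμ t
  rw [eq_inv_mul_iff_mul_eq₀ hne, charFun_apply_real] at h
  rw [integral_smul_measure, ENNReal.toReal_ofReal h0.le, Complex.real_smul, hre, ← h]
  congr 2 with ν
  push_cast
  ring_nf
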